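/- Let C be any congestion policy with C(ℓ) ≤ 1/ℓ for every ℓ ∈ {1,…,k} (e.g., the sharing policy C(ℓ) = 1/ℓ), and let ε ≥ 0. If P is a profile of k strategies that is a (1+ε)-equilibrium, then for every profile P′ of k strategies, success(P) ≥ success(P′)/(2+ε). In particular the price of anarchy of such a policy is at most 2. -/

import Mathlib

open Finset

/-- `A` is a doubly-substochastic `M × T` matrix: boxes `1..M`, rounds `1..T`,
nonnegative entries, every row and every column sums to at most 1. -/
def Substochastic (M T : ℕ) (A : ℕ → ℕ → ℝ) : Prop :=
  (∀ x t, 0 ≤ A x t) ∧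
  (∀ x ∈ Icc 1 M, ∑ t ∈ Icc 1 T, A x t ≤ 1) ∧
  (∀ t ∈ Icc 1 T, ∑ x ∈ Icc 1 M, A x t ≤ 1)

/-- `N̄_A(x,t)`: the probability that `A` does not visit box `x` by (and including) round `t`. -/
def Nbar (A : ℕ → ℕ → ℝ) (x t : ℕ) : ℝ := 1 - ∑ s ∈ Icc 1 t, A x s

/-- `f` is a positive, nonincreasing probability distribution on boxes `1..M`. -/
def BoxDist (M : ℕ) (f : ℕ → ℝ) : Prop :=
  (∀ x ∈ Icc 1 M, 0 < f x) ∧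
  (∀ x, 1 ≤ x → x + 1 ≤ M → f (x + 1) ≤ f x) ∧
  (∑ x ∈ Icc 1 M, f x = 1)

/-- `C` is a congestion policy for `k` players: nonnegative, nonincreasing on `1..k`,
`C 1 = 1`, and `C ℓ < 1` for some `ℓ ≤ k`. -/
def Policy (k : ℕ) (C : ℕ → ℝ) : Prop :=
  (∀ ℓ, 1 ≤ ℓ → ℓ ≤ k → 0 ≤ C ℓ) ∧ (C 1 = 1) ∧
  (∀ ℓ ℓ', 1 ≤ ℓ → ℓ ≤ ℓ' → ℓ' ≤ k → C ℓ' ≤ C ℓ) ∧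
  (∃ ℓ, 1 ≤ ℓ ∧ ℓ ≤ k ∧ C ℓ < 1)

/-- The value of box `x` at round `t` against `k-1` copies of `A`. -/
def val (k : ℕ) (C f : ℕ → ℝ) (A : ℕ → ℕ → ℝ) (x t : ℕ) : ℝ :=
  f x * ∑ ℓ ∈ range k,
    C (ℓ + 1) * ((k - 1).choose ℓ : ℝ) * A x t ^ ℓ * Nbar A x t ^ (k - 1 - ℓ)

/-- The utility of `B` against `k-1` copies of `A`. -/
def util (M T k : ℕ) (C f : ℕ → ℝ) (A B : ℕ → ℕ → ℝ) : ℝ :=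
  ∑ t ∈ Icc 1 T, ∑ x ∈ Icc 1 M, B x t * val k C f A x t

/-- `A` is non-redundant: each column `t ≤ min T M` sums to exactly 1. -/
def NonRedundant (M T : ℕ) (A : ℕ → ℕ → ℝ) : Prop :=
  ∀ t, 1 ≤ t → t ≤ min T M → ∑ x ∈ Icc 1 M, A x t = 1

/-- `A` is self-greedy: for each round `t ≤ T` it is greedy at round `t` with respect to
`k-1` copies of itself. -/
def SGreedy (M T k : ℕ) (C f : ℕ → ℝ) (A : ℕ → ℕ → ℝ) : Prop :=
  ∀ t, 1 ≤ t → t ≤ T → ∀ B, Substochastic M T B →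
    (∀ x s, s < t → B x s = A x s) →
    ∑ x ∈ Icc 1 M, B x t * val k C f A x t ≤ ∑ x ∈ Icc 1 M, A x t * val k C f A x t

noncomputable instance : DecidableEq (ℕ → ℕ → ℝ) := Classical.decEq _

/-- The value of box `x` at round `t` against the profile `P` (a multiset of strategies):
`v_P(x,t) = f(x)·Σ_ℓ C(ℓ+1)·Σ_{I ⊆ P, |I| = ℓ} Π_{A∈I} A(x,t) · Π_{A∈P∖I} N̄_A(x,t)`. -/
noncomputable def pVal (C f : ℕ → ℝ) (P : Multiset (ℕ → ℕ → ℝ)) (x t : ℕ) : ℝ :=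
  f x * ∑ ℓ ∈ range (Multiset.card P + 1), C (ℓ + 1) *
    ((P.powersetCard ℓ).map fun I =>
      (I.map fun A => A x t).prod * ((P - I).map fun A => Nbar A x t).prod).sum

/-- The utility of `B` against the profile `P`. -/
noncomputable def pUtil (M T : ℕ) (C f : ℕ → ℝ) (P : Multiset (ℕ → ℕ → ℝ)) (B : ℕ → ℕ → ℝ) : ℝ :=
  ∑ t ∈ Icc 1 T, ∑ x ∈ Icc 1 M, B x t * pVal C f P x t

/-- The success probability of the profile `P`. -/
def success (M T : ℕ) (f : ℕ → ℝ) (P : Multiset (ℕ → ℕ → ℝ)) : ℝ :=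
  ∑ x ∈ Icc 1 M, f x * (1 - (P.map fun A => Nbar A x T).prod)

/-- The sum over the `ℓ`-element sub-multisets `I` of `P` of `Π_{i ∈ I} a i · Π_{i ∈ P - I} n i`. -/
noncomputable def mixedEsymm {α : Type*} [DecidableEq α] (a n : α → ℝ) (P : Multiset α) (ℓ : ℕ) :
    ℝ :=
  ((P.powersetCard ℓ).map fun I => (I.map a).prod * ((P - I).map n).prod).sum

/-- The generating polynomial of `mixedEsymm a n P`. -/
noncomputable def mixedPoly {α : Type*} (a n : α → ℝ) (P : Multiset α) : Polynomial ℝ :=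
  (P.map fun i => Polynomial.C (n i) + Polynomial.C (a i) * Polynomial.X).prod

section Mixed

variable {α : Type*} [DecidableEq α] (a n : α → ℝ) (P : Multiset α)

theorem mixedPoly_eq_sum :
    mixedPoly a n P = ∑ ℓ ∈ range (Multiset.card P + 1),
      Polynomial.C (mixedEsymm a n P ℓ) * Polynomial.X ^ ℓ := by
  rw [mixedPoly, Multiset.prod_map_add, Multiset.antidiagonal_eq_map_powerset, Multiset.map_map,
    ← Multiset.bind_powerset_len, Multiset.map_bind, Multiset.sum_bind]
  refine congrArg Multiset.sum (Multiset.map_congr rfl fun ℓ _ => ?_)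
  rw [mixedEsymm, map_multiset_sum Polynomial.C, ← Multiset.sum_map_mul_right, Multiset.map_map]
  refine congrArg Multiset.sum (Multiset.map_congr rfl fun I hI => ?_)
  obtain ⟨-, hI⟩ := Multiset.mem_powersetCard.1 hI
  simp only [Function.comp, Multiset.prod_map_mul, Multiset.map_const', Multiset.prod_replicate,
    map_mul, map_multiset_prod, Multiset.map_map, hI]
  ring

theorem coeff_mixedPoly (ℓ : ℕ) : (mixedPoly a n P).coeff ℓ = mixedEsymm a n P ℓ := by
  rw [mixedPoly_eq_sum, Polynomial.finsetSum_coeff]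
  simp only [Polynomial.coeff_C_mul_X_pow, Finset.sum_ite_eq, Finset.mem_range]
  split_ifs with h
  · rfl
  · rw [mixedEsymm, Multiset.powersetCard_eq_empty _ (by omega)]
    simp

theorem mixedEsymm_zero : mixedEsymm a n P 0 = (P.map n).prod := by
  simp [mixedEsymm]

theorem sum_mixedEsymm :
    ∑ ℓ ∈ range (Multiset.card P + 1), mixedEsymm a n P ℓ =
      (P.map fun i => n i + a i).prod := by
  have h := congrArg (Polynomial.eval 1) (mixedPoly_eq_sum a n P)
  rw [mixedPoly, Polynomial.eval_multiset_prod, Multiset.map_map, Polynomial.eval_finsetSum] at h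
  simpa using h.symm

/-- Choosing a distinguished member of an `(ℓ + 1)`-element sub-multiset. -/
theorem sum_mul_mixedEsymm_erase (ℓ : ℕ) :
    (P.map fun i => a i * mixedEsymm a n (P.erase i) ℓ).sum =
      (ℓ + 1) * mixedEsymm a n P (ℓ + 1) := by
  have h := congrArg (fun p => Polynomial.coeff p ℓ)
    (Polynomial.derivative_prod (s := P)
      (f := fun i => Polynomial.C (n i) + Polynomial.C (a i) * Polynomial.X))
  change (Polynomial.derivative (mixedPoly a n P)).coeff ℓ = _ at h
  rw [Polynomial.coeff_derivative, coeff_mixedPoly] at h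
  rw [mul_comm, h, ← Polynomial.lcoeff_apply, map_multiset_sum, Multiset.map_map]
  refine congrArg Multiset.sum (Multiset.map_congr rfl fun i _ => ?_)
  change _ = (mixedPoly a n (P.erase i) *
    Polynomial.derivative (Polynomial.C (n i) + Polynomial.C (a i) * Polynomial.X)).coeff ℓ
  rw [Polynomial.derivative_add, Polynomial.derivative_C, zero_add, Polynomial.derivative_C_mul_X,
    Polynomial.coeff_mul_C, coeff_mixedPoly, mul_comm]

variable {a n P}

theorem mixedEsymm_nonneg (ha : ∀ i ∈ P, 0 ≤ a i) (hn : ∀ i ∈ P, 0 ≤ n i) (ℓ : ℕ) :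
    0 ≤ mixedEsymm a n P ℓ := by
  refine Multiset.sum_nonneg fun y hy => ?_
  obtain ⟨I, hI, rfl⟩ := Multiset.mem_map.1 hy
  have hIP := (Multiset.mem_powersetCard.1 hI).1
  refine mul_nonneg (Multiset.prod_nonneg fun z hz => ?_) (Multiset.prod_nonneg fun z hz => ?_)
  · obtain ⟨i, hi, rfl⟩ := Multiset.mem_map.1 hz
    exact ha i (Multiset.mem_of_le hIP hi)
  · obtain ⟨i, hi, rfl⟩ := Multiset.mem_map.1 hz
    exact hn i (Multiset.mem_of_le (Multiset.sub_le_self _ _) hi)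

end Mixed

theorem multiset_prod_map_nonneg {α : Type*} {n : α → ℝ} {P : Multiset α}
    (hn : ∀ i ∈ P, 0 ≤ n i) : 0 ≤ (P.map n).prod :=
  Multiset.prod_nonneg fun z hz => by
    obtain ⟨i, hi, rfl⟩ := Multiset.mem_map.1 hz
    exact hn i hi

theorem multiset_prod_map_le_one {α : Type*} {n : α → ℝ} {P : Multiset α}
    (h0 : ∀ i ∈ P, 0 ≤ n i) (h1 : ∀ i ∈ P, n i ≤ 1) : (P.map n).prod ≤ 1 := by
  simpa using Multiset.prod_map_le_prod_map₀ n (fun _ => 1) h0 h1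

/-- The union bound for independent events. -/
theorem one_sub_multiset_prod_le_sum {α : Type*} {n : α → ℝ} {P : Multiset α}
    (h0 : ∀ i ∈ P, 0 ≤ n i) (h1 : ∀ i ∈ P, n i ≤ 1) :
    1 - (P.map n).prod ≤ (P.map fun i => 1 - n i).sum := by
  induction P using Multiset.induction_on with
  | empty => simp
  | cons i P ih =>
    simp only [Multiset.mem_cons, forall_eq_or_imp] at h0 h1
    have hP := multiset_prod_map_le_one h0.2 h1.2
    have := ih h0.2 h1.2
    simp only [Multiset.map_cons, Multiset.prod_cons, Multiset.sum_cons]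
    nlinarith [mul_nonneg (sub_nonneg.2 h1.1) (sub_nonneg.2 hP)]

theorem sum_Icc_sub_telescope (g : ℕ → ℝ) (T : ℕ) :
    ∑ t ∈ Icc 1 T, (g (t - 1) - g t) = g 0 - g T := by
  induction T with
  | zero => simp
  | succ T ih => rw [Finset.sum_Icc_succ_top (by omega), ih]; simp

section Strategies

variable {M T : ℕ} {A : ℕ → ℕ → ℝ}

theorem Nbar_antitone (hA : Substochastic M T A) (x : ℕ) {s t : ℕ} (hst : s ≤ t) :
    Nbar A x t ≤ Nbar A x s :=
  sub_le_sub_left (Finset.sum_le_sum_of_subset_of_nonneg (Icc_subset_Icc_right hst)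
    fun _ _ _ => hA.1 _ _) _

theorem Nbar_zero (A : ℕ → ℕ → ℝ) (x : ℕ) : Nbar A x 0 = 1 := by simp [Nbar]

theorem Nbar_le_one (hA : Substochastic M T A) (x t : ℕ) : Nbar A x t ≤ 1 :=
  Nbar_zero A x ▸ Nbar_antitone hA x (Nat.zero_le t)

theorem Nbar_nonneg (hA : Substochastic M T A) {x t : ℕ} (hx : x ∈ Icc 1 M) (ht : t ≤ T) :
    0 ≤ Nbar A x t :=
  (sub_nonneg.2 (hA.2.1 x hx)).trans (Nbar_antitone hA x ht)

theorem Nbar_add (A : ℕ → ℕ → ℝ) (x : ℕ) {t : ℕ} (ht : 1 ≤ t) :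
    Nbar A x t + A x t = Nbar A x (t - 1) := by
  obtain ⟨s, rfl⟩ := Nat.exists_eq_add_of_le' ht
  rw [Nbar, Finset.sum_Icc_succ_top (by omega), Nbar, Nat.add_sub_cancel]
  ring

end Strategies

theorem pVal_eq (C f : ℕ → ℝ) (P : Multiset (ℕ → ℕ → ℝ)) (x t : ℕ) :
    pVal C f P x t = f x * ∑ ℓ ∈ range (Multiset.card P + 1),
      C (ℓ + 1) * mixedEsymm (fun A => A x t) (fun A => Nbar A x t) P ℓ := rfl

section Profiles

variable {M T k : ℕ} {C f : ℕ → ℝ} {P : Multiset (ℕ → ℕ → ℝ)}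

/-- A box is worth at least its value when found alone. -/
theorem le_pVal (hC : Policy k C) (hf : BoxDist M f) (hcard : Multiset.card P + 1 ≤ k)
    (hsub : ∀ A ∈ P, Substochastic M T A) {x t : ℕ} (hx : x ∈ Icc 1 M) (ht : t ≤ T) :
    f x * (P.map fun A => Nbar A x t).prod ≤ pVal C f P x t := by
  rw [pVal_eq]
  refine mul_le_mul_of_nonneg_left ?_ (hf.1 x hx).le
  refine le_trans ?_ (Finset.single_le_sum (fun ℓ hℓ => mul_nonneg
    (hC.1 (ℓ + 1) (by omega) (by have := Finset.mem_range.1 hℓ; omega))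
    (mixedEsymm_nonneg (fun A hA => (hsub A hA).1 x t)
      (fun A hA => Nbar_nonneg (hsub A hA) hx ht) ℓ))
    (Finset.mem_range.2 (Nat.succ_pos _)))
  rw [mixedEsymm_zero, zero_add, hC.2.1, one_mul]

/-- At most the value of the box is shared among the players who first find it at round `t`. -/
theorem sum_mul_pVal_erase_le (hf : BoxDist M f)
    (hCshare : ∀ ℓ : ℕ, 1 ≤ ℓ → ℓ ≤ k → C ℓ ≤ 1 / (ℓ : ℝ)) (hcard : Multiset.card P = k)
    (hsub : ∀ A ∈ P, Substochastic M T A) {x t : ℕ} (hx : x ∈ Icc 1 M) (ht : t ∈ Icc 1 T) :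
    (P.map fun A => A x t * pVal C f (P.erase A) x t).sum ≤
      f x * ((P.map fun A => Nbar A x (t - 1)).prod - (P.map fun A => Nbar A x t).prod) := by
  obtain ⟨ht1, htT⟩ := Finset.mem_Icc.1 ht
  set a : (ℕ → ℕ → ℝ) → ℝ := fun A => A x t with ha
  set n : (ℕ → ℕ → ℝ) → ℝ := fun A => Nbar A x t with hn
  have hE : ∀ ℓ, 0 ≤ mixedEsymm a n P ℓ := mixedEsymm_nonneg (fun A hA => (hsub A hA).1 x t)
    fun A hA => Nbar_nonneg (hsub A hA) hx htT
  have hprev : (P.map fun A => Nbar A x (t - 1)).prod =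
      ∑ ℓ ∈ range k, mixedEsymm a n P (ℓ + 1) + (P.map n).prod := by
    rw [← mixedEsymm_zero a n P, ← Finset.sum_range_succ', ← hcard, sum_mixedEsymm]
    simp only [ha, hn, Nbar_add _ x ht1]
  have hsum : (P.map fun A => A x t * pVal C f (P.erase A) x t).sum =
      f x * ∑ ℓ ∈ range k, C (ℓ + 1) * ((ℓ + 1) * mixedEsymm a n P (ℓ + 1)) := by
    simp only [← sum_mul_mixedEsymm_erase, ← Multiset.sum_map_mul_left, Finset.mul_sum]
    rw [← Multiset.sum_map_sum]
    refine congrArg Multiset.sum (Multiset.map_congr rfl fun A hA => ?_)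
    rw [pVal_eq, Multiset.card_erase_add_one hA, hcard, Finset.mul_sum, Finset.mul_sum]
    exact Finset.sum_congr rfl fun ℓ _ => by ring
  rw [hsum, hprev, add_sub_cancel_right]
  refine mul_le_mul_of_nonneg_left (Finset.sum_le_sum fun ℓ hℓ => ?_) (hf.1 x hx).le
  have hℓ' := hCshare (ℓ + 1) (by omega) (Finset.mem_range.1 hℓ)
  rw [le_div_iff₀ (by positivity)] at hℓ'
  push_cast at hℓ'
  rw [← mul_assoc]
  exact mul_le_of_le_one_left (hE _) hℓ'

theorem sum_pUtil_erase_le_success (hf : BoxDist M f)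
    (hCshare : ∀ ℓ : ℕ, 1 ≤ ℓ → ℓ ≤ k → C ℓ ≤ 1 / (ℓ : ℝ)) (hcard : Multiset.card P = k)
    (hsub : ∀ A ∈ P, Substochastic M T A) :
    (P.map fun A => pUtil M T C f (P.erase A) A).sum ≤ success M T f P := by
  have hswap : (P.map fun A => pUtil M T C f (P.erase A) A).sum =
      ∑ x ∈ Icc 1 M, ∑ t ∈ Icc 1 T, (P.map fun A => A x t * pVal C f (P.erase A) x t).sum := by
    rw [Finset.sum_comm]
    simp only [pUtil, Multiset.sum_map_sum]
  rw [hswap, success]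
  refine Finset.sum_le_sum fun x hx => ?_
  refine (Finset.sum_le_sum fun t ht =>
    sum_mul_pVal_erase_le hf hCshare hcard hsub hx ht).trans_eq ?_
  rw [← Finset.mul_sum, sum_Icc_sub_telescope fun t => (P.map fun A => Nbar A x t).prod]
  simp [Nbar_zero]

/-- Deviating to `B` earns at least the boxes that `B` visits and the profile `P` misses. -/
theorem le_pUtil_erase (hC : Policy k C) (hf : BoxDist M f) (hcard : Multiset.card P = k)
    (hsub : ∀ A ∈ P, Substochastic M T A) {A B : ℕ → ℕ → ℝ} (hA : A ∈ P)
    (hB : Substochastic M T B) :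
    ∑ x ∈ Icc 1 M, f x * (P.map fun A => Nbar A x T).prod * (1 - Nbar B x T) ≤
      pUtil M T C f (P.erase A) B := by
  rw [pUtil, Finset.sum_comm]
  refine Finset.sum_le_sum fun x hx => ?_
  rw [Nbar, sub_sub_cancel, Finset.mul_sum]
  refine Finset.sum_le_sum fun t ht => ?_
  have htT := (Finset.mem_Icc.1 ht).2
  have hsub' : ∀ A' ∈ P.erase A, Substochastic M T A' :=
    fun A' hA' => hsub A' (Multiset.mem_of_mem_erase hA')
  rw [mul_comm]
  refine mul_le_mul_of_nonneg_left ?_ (hB.1 x t)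
  refine le_trans (mul_le_mul_of_nonneg_left ?_ (hf.1 x hx).le)
    (le_pVal hC hf (Multiset.card_erase_add_one hA |>.trans hcard).le hsub' hx htT)
  rw [← Multiset.prod_map_erase hA]
  refine (mul_le_of_le_one_left (multiset_prod_map_nonneg fun A' hA' =>
    Nbar_nonneg (hsub' A' hA') hx le_rfl) (Nbar_le_one (hsub A hA) x T)).trans ?_
  exact Multiset.prod_map_le_prod_map₀ _ _ (fun A' hA' => Nbar_nonneg (hsub' A' hA') hx le_rfl)
    fun A' hA' => Nbar_antitone (hsub' A' hA') x htT

end Profiles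

/-- for any congestion policy with `C(ℓ) ≤ 1/ℓ` (e.g. the sharing policy),
any `(1+ε)`-equilibrium profile of `k` strategies achieves at least a `1/(2+ε)` fraction of
the success probability of any profile of `k` strategies. -/
theorem sharing_PoA
    (M T k : ℕ) (hM : 1 ≤ M) (hT : 1 ≤ T) (hk : 2 ≤ k)
    (C f : ℕ → ℝ) (hC : Policy k C) (hf : BoxDist M f)
    (hCshare : ∀ ℓ : ℕ, 1 ≤ ℓ → ℓ ≤ k → C ℓ ≤ 1 / (ℓ : ℝ))
    (ε : ℝ) (hε : 0 ≤ ε)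
    (P : Multiset (ℕ → ℕ → ℝ)) (hcard : Multiset.card P = k)
    (hsub : ∀ A ∈ P, Substochastic M T A)
    (hnash : ∀ A ∈ P, ∀ B, Substochastic M T B →
      pUtil M T C f (P.erase A) B ≤ (1 + ε) * pUtil M T C f (P.erase A) A)
    (P' : Multiset (ℕ → ℕ → ℝ)) (hcard' : Multiset.card P' = k)
    (hsub' : ∀ A ∈ P', Substochastic M T A) :
    success M T f P' / (2 + ε) ≤ success M T f P := by
  have hk0 : (0 : ℝ) < k := by exact_mod_cast (by omega : 0 < k)
  set S := success M T f P with hS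
  set Q : ℕ → ℝ := fun x => (P.map fun A => Nbar A x T).prod with hQ
  set W : (ℕ → ℕ → ℝ) → ℝ := fun B => ∑ x ∈ Icc 1 M, f x * Q x * (1 - Nbar B x T) with hW
  have hQ0 : ∀ x ∈ Icc 1 M, 0 ≤ Q x := fun x hx =>
    multiset_prod_map_nonneg fun A hA => Nbar_nonneg (hsub A hA) hx le_rfl
  have hQ1 : ∀ x ∈ Icc 1 M, Q x ≤ 1 := fun x hx => multiset_prod_map_le_one
    (fun A hA => Nbar_nonneg (hsub A hA) hx le_rfl) fun A hA => Nbar_le_one (hsub A hA) x T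
  have hWB : ∀ B ∈ P', k * W B ≤ (1 + ε) * S := fun B hB => by
    have h : (P.map fun _ => W B).sum ≤
        (P.map fun A => (1 + ε) * pUtil M T C f (P.erase A) A).sum :=
      Multiset.sum_map_le_sum_map _ _ fun A hA =>
        (le_pUtil_erase hC hf hcard hsub hA (hsub' B hB)).trans (hnash A hA B (hsub' B hB))
    rw [Multiset.sum_map_mul_left, Multiset.map_const', Multiset.sum_replicate, hcard,
      nsmul_eq_mul] at h
    exact h.trans (mul_le_mul_of_nonneg_left
      (sum_pUtil_erase_le_success hf hCshare hcard hsub) (by linarith))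
  have hWsum : (P'.map W).sum ≤ (1 + ε) * S := by
    have h : (P'.map fun B => k * W B).sum ≤ (P'.map fun _ => (1 + ε) * S).sum :=
      Multiset.sum_map_le_sum_map _ _ hWB
    rw [Multiset.sum_map_mul_left, Multiset.map_const', Multiset.sum_replicate, hcard',
      nsmul_eq_mul] at h
    exact le_of_mul_le_mul_left h hk0
  have hgap : success M T f P' - S ≤ (P'.map W).sum := by
    simp only [hW, Multiset.sum_map_sum, Multiset.sum_map_mul_left]
    rw [hS, success, success, ← Finset.sum_sub_distrib]
    refine Finset.sum_le_sum fun x hx => ?_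
    have h0 : ∀ B ∈ P', 0 ≤ Nbar B x T := fun B hB => Nbar_nonneg (hsub' B hB) hx le_rfl
    have h1 : ∀ B ∈ P', Nbar B x T ≤ 1 := fun B hB => Nbar_le_one (hsub' B hB) x T
    have hunion := one_sub_multiset_prod_le_sum h0 h1
    have hR0 := multiset_prod_map_nonneg h0
    rw [mul_assoc, ← mul_sub]
    refine mul_le_mul_of_nonneg_left ?_ (hf.1 x hx).le
    refine le_trans ?_ (mul_le_mul_of_nonneg_left hunion (hQ0 x hx))
    change 1 - _ - (1 - Q x) ≤ _
    nlinarith [mul_nonneg hR0 (sub_nonneg.2 (hQ1 x hx))]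
  rw [div_le_iff₀ (by linarith)]
  linarith
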